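/- Let q = 2^n, k a positive integer, d = gcd(n,k) with n/d odd and k ∉ {n/3, 2n/3}. For (α,β,γ) ranging over F_q^3, the sum S(α,β,γ) = Σ_{x ∈ F_q}(-1)^{Tr(α x^{2^{2k}+1} + β x^{2^k+1} + γ x)} takes the value 0 exactly (2^n−1)(2^{2n} − 2^{2n−d} + 2^{2n−4d} + 2^n − 2^{n−d} − 2^{n−3d} + 1) times. -/

import Mathlib

open Module

/-- The radical of an alternating form has the same parity as the whole space. -/
theorem LinearMap.BilinForm.IsAlt.even_finrank_add_finrank_ker {K V : Type*} [Field K]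
    [AddCommGroup V] [Module K V] [FiniteDimensional K V] {B : LinearMap.BilinForm K V}
    (hB : B.IsAlt) : Even (finrank K V + finrank K (LinearMap.ker B)) := by
  obtain ⟨W, hW, hmax⟩ := WellFounded.has_min
    (wellFounded_gt : WellFounded ((· > ·) : Submodule K V → Submodule K V → Prop))
    {W | W ≤ B.orthogonal W} ⟨⊥, bot_le (a := B.orthogonal ⊥)⟩
  have hker : LinearMap.ker B ≤ B.orthogonal W := fun x hx w _ => by
    rw [← hB.neg_eq, LinearMap.mem_ker.1 hx]
    simp
  have hortho : B.orthogonal W ≤ W := by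
    intro x hx
    by_contra hxW
    refine hmax (W ⊔ K ∙ x) ?_ ?_
    · have hx' : ∀ w ∈ W, B w x = 0 := hx
      have hx'' : ∀ w ∈ W, B x w = 0 := fun w hw => by rw [← hB.neg_eq, hx' w hw, neg_zero]
      intro y hy z hz
      obtain ⟨w, hw, u, hu, rfl⟩ := Submodule.mem_sup.1 hy
      obtain ⟨w', hw', u', hu', rfl⟩ := Submodule.mem_sup.1 hz
      obtain ⟨c, rfl⟩ := Submodule.mem_span_singleton.1 hu
      obtain ⟨c', rfl⟩ := Submodule.mem_span_singleton.1 hu'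
      have : B w' w = 0 := hW hw w' hw'
      simp [this, hx' _ hw', hx'' _ hw, hB.self_eq_zero]
    · exact lt_of_le_of_ne le_sup_left fun h => hxW <| h ▸
        (le_sup_right : K ∙ x ≤ W ⊔ K ∙ x) (Submodule.mem_span_singleton_self x)
  have h := LinearMap.BilinForm.finrank_add_finrank_orthogonal' (B := B) W
  rw [le_antisymm hortho hW, inf_eq_right.2 (hker.trans hortho)] at h
  exact ⟨_, h.symm⟩

/-- A nonzero polynomial of degree at most `m` in a field automorphism `σ` has at most `Q ^ m`
zeros, where `Q` is the number of fixed points of `σ`. -/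
theorem card_zeros_skewPolynomial_le {F : Type*} [Field F] [Finite F] (σ : F →+* F) (m : ℕ)
    (a : ℕ → F) (ha : ∃ i ≤ m, a i ≠ 0) :
    Nat.card {x : F // ∑ i ∈ Finset.range (m + 1), a i * σ^[i] x = 0} ≤
      Nat.card {x : F // σ x = x} ^ m := by
  induction m generalizing a with
  | zero =>
    obtain ⟨i, hi, hai⟩ := ha
    obtain rfl : i = 0 := by omega
    have : Subsingleton {x : F // ∑ i ∈ Finset.range (0 + 1), a i * σ^[i] x = 0} := by
      refine ⟨fun x y => Subtype.ext ?_⟩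
      have hx := x.2
      have hy := y.2
      simp [hai] at hx hy
      rw [hx, hy]
    simpa using Finite.card_le_one_iff_subsingleton.2 this
  | succ m ih =>
    by_cases hu : ∃ u : F, u ≠ 0 ∧ ∑ i ∈ Finset.range (m + 1 + 1), a i * σ^[i] u = 0
    swap
    · push Not at hu
      have : Subsingleton {x : F // ∑ i ∈ Finset.range (m + 1 + 1), a i * σ^[i] x = 0} := by
        refine ⟨fun x y => Subtype.ext ?_⟩
        rw [not_not.1 fun h => hu x.1 h x.2, not_not.1 fun h => hu y.1 h y.2]
      have : Nonempty {x : F // σ x = x} := ⟨0, map_zero σ⟩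
      exact (Finite.card_le_one_iff_subsingleton.2 ‹_›).trans (Nat.one_le_pow _ _ Nat.card_pos)
    obtain ⟨u, hu0, hu⟩ := hu
    have hσu : ∀ i, σ^[i] u ≠ 0 := fun i => by
      rw [← RingHom.coe_pow]; exact (map_ne_zero _).2 hu0
    -- with `c i = a i * σ^[i] u`, one has `L (u * y) = M (y - σ y)`
    set c : ℕ → F := fun i => a i * σ^[i] u with hc
    set b : ℕ → F := fun i => ∑ j ∈ Finset.range (i + 1), c j with hb
    have key : ∀ (y : F) (N : ℕ), ∑ i ∈ Finset.range (N + 1), a i * σ^[i] (u * y) =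
        ∑ i ∈ Finset.range N, b i * σ^[i] (y - σ y) + b N * σ^[N] y := by
      intro y N
      have hmul : ∀ i, σ^[i] (u * y) = σ^[i] u * σ^[i] y := fun i => by
        simp only [← RingHom.coe_pow, map_mul]
      have hsub : ∀ i, σ^[i] (y - σ y) = σ^[i] y - σ^[i + 1] y := fun i => by
        rw [Function.iterate_succ_apply]; simp only [← RingHom.coe_pow, map_sub]
      induction N with
      | zero => simp [hb, hc, mul_assoc]
      | succ N ihN =>
        rw [Finset.sum_range_succ, ihN, Finset.sum_range_succ _ N, hmul, hsub]
        have : b (N + 1) = b N + a (N + 1) * σ^[N + 1] u := by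
          simp only [hb, Finset.sum_range_succ _ (N + 1), hc]
        rw [this]; ring
    have hbm : b (m + 1) = 0 := hu
    have hbne : ∃ i ≤ m, b i ≠ 0 := by
      by_contra! h
      obtain ⟨i, hi, hai⟩ := ha
      have hb' : ∀ j ≤ m + 1, b j = 0 := fun j hj => by
        rcases Nat.lt_or_ge m j with hj' | hj'
        · obtain rfl : j = m + 1 := by omega
          exact hbm
        · exact h j hj'
      have : c i = 0 := by
        cases i with
        | zero => simpa [hb] using hb' 0 hi
        | succ i =>
          have h1 := hb' (i + 1) hi
          have h2 := hb' i (by omega)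
          simp only [hb] at h1 h2
          rwa [Finset.sum_range_succ, h2, zero_add] at h1
      exact mul_ne_zero hai (hσu i) this
    let M : F →+ F := ∑ i ∈ Finset.range (m + 1),
      (AddMonoidHom.mulLeft (b i)).comp ((σ ^ i : F →+* F) : F →+ F)
    have hM : ∀ y, M y = ∑ i ∈ Finset.range (m + 1), b i * σ^[i] y := fun y => by
      simp [M, AddMonoidHom.finsetSum_apply, RingHom.coe_pow]
    let D : F →+ F := AddMonoidHom.id F - (σ : F →+ F)
    have hD : ∀ y, D y = y - σ y := fun y => rfl
    have hzero : ∀ x : F, ∑ i ∈ Finset.range (m + 1 + 1), a i * σ^[i] x = 0 ↔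
        M (D (u⁻¹ * x)) = 0 := fun x => by
      have := key (u⁻¹ * x) (m + 1)
      rw [mul_inv_cancel_left₀ hu0, hbm, zero_mul, add_zero] at this
      rw [this, hM, hD]
    have hM' := ih b hbne
    have hcard : Nat.card {x : F // ∑ i ∈ Finset.range (m + 1 + 1), a i * σ^[i] x = 0} =
        Nat.card (M.comp D).ker :=
      Nat.card_congr ((Equiv.mulLeft₀ u⁻¹ (inv_ne_zero hu0)).subtypeEquiv fun x => by
        simpa [AddMonoidHom.mem_ker] using hzero x)
    have hDk : Nat.card D.ker = Nat.card {x : F // σ x = x} :=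
      Nat.card_congr (Equiv.subtypeEquivRight fun x => by
        rw [AddMonoidHom.mem_ker, hD, sub_eq_zero, eq_comm])
    have hMk : Nat.card M.ker =
        Nat.card {x : F // ∑ i ∈ Finset.range (m + 1), b i * σ^[i] x = 0} :=
      Nat.card_congr (Equiv.subtypeEquivRight fun x => by rw [AddMonoidHom.mem_ker, hM])
    let f : (M.comp D).ker →+ M.ker := (D.comp (M.comp D).ker.subtype).codRestrict M.ker
      fun x => x.2
    have hf : Nat.card (M.comp D).ker = Nat.card f.range * Nat.card f.ker := by
      rw [← Nat.card_congr (QuotientAddGroup.quotientKerEquivRange f).toEquiv]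
      exact AddSubgroup.card_eq_card_quotient_mul_card_addSubgroup _
    have hfk : Nat.card f.ker ≤ Nat.card D.ker :=
      Nat.card_le_card_of_injective (fun x => (⟨x.1.1, by
        have := x.2
        rw [AddMonoidHom.mem_ker] at this
        exact congrArg Subtype.val this⟩ : D.ker))
        fun x y h => Subtype.ext (Subtype.ext (Subtype.mk.inj h))
    rw [hcard, hf, pow_succ]
    exact Nat.mul_le_mul ((Nat.card_le_card_of_injective _ Subtype.val_injective).trans
      (hMk.le.trans hM')) (hfk.trans hDk.le)

section TraceSign

variable {F : Type*} [Field F] [Algebra (ZMod 2) F]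

/-- The canonical additive character `(-1) ^ Tr a` of a finite field of characteristic two. -/
noncomputable def traceSign (a : F) : ℤ := (-1) ^ (Algebra.trace (ZMod 2) F a).val

theorem traceSign_zero : traceSign (0 : F) = 1 := by simp [traceSign]

theorem traceSign_add (a b : F) : traceSign (a + b) = traceSign a * traceSign b := by
  have h : ∀ s t : ZMod 2, (-1 : ℤ) ^ (s + t).val = (-1) ^ s.val * (-1) ^ t.val := by decide
  simp only [traceSign, map_add, h]

theorem traceSign_eq_or (a : F) : traceSign a = 1 ∨ traceSign a = -1 :=
  neg_one_pow_eq_or ℤ _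

theorem sum_traceSign_mul [Fintype F] [DecidableEq F] (c : F) :
    ∑ x : F, traceSign (c * x) = if c = 0 then (Fintype.card F : ℤ) else 0 := by
  split_ifs with hc
  · simp [hc, traceSign_zero]
  · obtain ⟨y, hy⟩ : ∃ y, Algebra.trace (ZMod 2) F (c * y) ≠ 0 := by
      by_contra! h
      exact hc ((traceForm_nondegenerate (ZMod 2) F).1 c h)
    have hy1 : traceSign (c * y) = -1 := by
      have h : ∀ s : ZMod 2, s ≠ 0 → (-1 : ℤ) ^ s.val = -1 := by decide
      exact h _ hy
    have h := Equiv.sum_comp (Equiv.addRight y) fun x : F => traceSign (c * x)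
    simp only [Equiv.coe_addRight, mul_add, traceSign_add, hy1, mul_neg_one,
      Finset.sum_neg_distrib] at h
    linarith

theorem two_eq_zero_of_algebra_zmod : (2 : F) = 0 := by
  have : CharP F 2 := charP_of_injective_algebraMap (algebraMap (ZMod 2) F).injective 2
  exact CharTwo.two_eq_zero

end TraceSign

section PolarMap

variable {K F : Type*} [Field K] [Field F] [Algebra K F]

/-- The linear map `L` for which `Tr (y * L x)` is the polar form of the quadratic form
`Tr (a * x * σ² x + b * x * σ x)`. -/
def polarMap (σ : F ≃ₐ[K] F) (a b : F) : F →ₗ[K] F :=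
  LinearMap.mulLeft K a ∘ₗ σ.toLinearMap ∘ₗ σ.toLinearMap +
    σ.symm.toLinearMap ∘ₗ σ.symm.toLinearMap ∘ₗ LinearMap.mulLeft K a +
    LinearMap.mulLeft K b ∘ₗ σ.toLinearMap + σ.symm.toLinearMap ∘ₗ LinearMap.mulLeft K b

theorem polarMap_apply (σ : F ≃ₐ[K] F) (a b x : F) :
    polarMap σ a b x =
      a * σ (σ x) + σ.symm (σ.symm (a * x)) + b * σ x + σ.symm (b * x) := rfl

theorem trace_mul_polarMap (σ : F ≃ₐ[K] F) (a b x y : F) :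
    Algebra.trace K F (y * polarMap σ a b x) =
      Algebra.trace K F
        (a * (y * σ (σ x) + x * σ (σ y)) + b * (y * σ x + x * σ y)) := by
  have h1 : Algebra.trace K F (y * σ.symm (b * x)) = Algebra.trace K F (b * (x * σ y)) := by
    rw [← Algebra.trace_eq_of_algEquiv σ (y * σ.symm (b * x))]
    simp only [map_mul, AlgEquiv.apply_symm_apply]
    congr 1; ring
  have h2 : Algebra.trace K F (y * σ.symm (σ.symm (a * x))) =
      Algebra.trace K F (a * (x * σ (σ y))) := by
    rw [← Algebra.trace_eq_of_algEquiv σ, ← Algebra.trace_eq_of_algEquiv σ]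
    simp only [map_mul, AlgEquiv.apply_symm_apply]
    congr 1; ring
  simp only [polarMap_apply, mul_add, map_add, h1, h2, mul_left_comm y]
  ring

/-- The dimension of the radical has the same parity as the degree of the extension. -/
theorem even_finrank_add_finrank_ker_polarMap [FiniteDimensional K F] [Algebra.IsSeparable K F]
    (h2 : (2 : F) = 0) (σ : F ≃ₐ[K] F) (a b : F) :
    Even (finrank K F + finrank K (LinearMap.ker (polarMap σ a b))) := by
  let B : LinearMap.BilinForm K F := Algebra.traceForm K F ∘ₗ polarMap σ a b
  have hB : B.IsAlt := fun x => by
    change Algebra.trace K F (polarMap σ a b x * x) = 0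
    rw [mul_comm, trace_mul_polarMap, ← two_mul, ← two_mul, h2]
    simp
  have hker : LinearMap.ker B = LinearMap.ker (polarMap σ a b) :=
    LinearMap.ker_comp_of_ker_eq_bot _ (traceForm_nondegenerate K F).ker_eq_bot
  rw [← hker]
  exact hB.even_finrank_add_finrank_ker

theorem card_ker_polarMap_le [Finite F] (σ : F ≃ₐ[K] F) {a b : F}
    (hab : a ≠ 0 ∨ b ≠ 0) :
    Nat.card (LinearMap.ker (polarMap σ a b)) ≤ Nat.card {x : F // σ x = x} ^ 4 := by
  let c : ℕ → F := fun i =>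
    if i = 0 then a else if i = 1 then σ b else if i = 3 then σ (σ b) else
      if i = 4 then σ (σ a) else 0
  refine le_of_eq_of_le ?_ (card_zeros_skewPolynomial_le ((σ : F ≃+* F) : F →+* F) 4 c ?_)
  · refine Nat.card_congr (Equiv.subtypeEquivRight fun x => ?_)
    rw [LinearMap.mem_ker, ← (map_eq_zero_iff σ σ.injective),
      ← (map_eq_zero_iff σ σ.injective), polarMap_apply]
    simp only [map_add, map_mul, AlgEquiv.apply_symm_apply]
    simp [Finset.sum_range_succ, c]
    exact iff_of_eq (by congr 1; ring)
  · rcases hab with h | h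
    · exact ⟨0, by norm_num, by simpa [c] using h⟩
    · exact ⟨1, by norm_num, by simpa [c] using h⟩

/-- When the extension has odd degree, the radical has dimension one or three. -/
theorem card_ker_polarMap_eq_or [Finite F] (h2 : (2 : F) = 0) (σ : F ≃ₐ[K] F)
    (hσ : ∀ x, σ x = x → x ∈ Set.range (algebraMap K F)) (hodd : Odd (finrank K F)) {a b : F}
    (hab : a ≠ 0 ∨ b ≠ 0) :
    Nat.card (LinearMap.ker (polarMap σ a b)) = Nat.card K ∨
      Nat.card (LinearMap.ker (polarMap σ a b)) = Nat.card K ^ 3 := by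
  have := Finite.of_injective _ (algebraMap K F).injective
  have hfix : Nat.card {x : F // σ x = x} = Nat.card K :=
    (Nat.card_congr (Equiv.ofBijective
      (fun c : K => (⟨algebraMap K F c, σ.commutes c⟩ : {x : F // σ x = x}))
      ⟨fun c c' h => (algebraMap K F).injective (Subtype.mk.inj h), fun x => by
        obtain ⟨c, hc⟩ := hσ x.1 x.2
        exact ⟨c, Subtype.ext hc⟩⟩)).symm
  have hle := card_ker_polarMap_le σ hab
  have heven := even_finrank_add_finrank_ker_polarMap h2 σ a b
  rw [hfix, Module.natCard_eq_pow_finrank (K := K)] at hle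
  rw [Module.natCard_eq_pow_finrank (K := K) (V := LinearMap.ker (polarMap σ a b))]
  have hr := (Nat.pow_le_pow_iff_right Finite.one_lt_card).1 hle
  have hr' := (Nat.even_add'.1 heven).1 hodd
  obtain ⟨s, hs⟩ := hr'
  have : s = 0 ∨ s = 1 := by omega
  rcases this with rfl | rfl
  · left; rw [hs]; simp
  · right; rw [hs]; norm_num

end PolarMap

section QuadraticSum

variable {F : Type*} [Field F] [Algebra (ZMod 2) F] (σ : F ≃ₐ[ZMod 2] F)

/-- The quadratic phase `(-1) ^ Tr (a * x * σ² x + b * x * σ x + c * x)`. -/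
noncomputable def quadPhase (a b c x : F) : ℤ :=
  traceSign (a * (x * σ (σ x)) + b * (x * σ x) + c * x)

theorem quadPhase_add (a b c x z : F) :
    quadPhase σ a b c (x + z) =
      quadPhase σ a b c x * quadPhase σ a b c z * traceSign (polarMap σ a b z * x) := by
  have h : traceSign (polarMap σ a b z * x) =
      traceSign (a * (x * σ (σ z) + z * σ (σ x)) + b * (x * σ z + z * σ x)) := by
    rw [traceSign, mul_comm, trace_mul_polarMap, traceSign]
  simp only [h, quadPhase, ← traceSign_add, map_add]
  congr 1; ring

theorem quadPhase_mul_self (a b c x : F) : quadPhase σ a b c x * quadPhase σ a b c x = 1 := by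
  rcases traceSign_eq_or (a * (x * σ (σ x)) + b * (x * σ x) + c * x) with h | h <;>
    simp [quadPhase, h]

variable [Fintype F]

/-- The exponential sum of the quadratic phase. -/
noncomputable def quadSum (a b c : F) : ℤ := ∑ x : F, quadPhase σ a b c x

open Classical in
theorem quadSum_mul_self (a b c : F) :
    quadSum σ a b c * quadSum σ a b c =
      Fintype.card F * ∑ z : LinearMap.ker (polarMap σ a b), quadPhase σ a b c z := by
  have h : ∀ x, ∑ y, quadPhase σ a b c x * quadPhase σ a b c y =
      ∑ z, quadPhase σ a b c z * traceSign (polarMap σ a b z * x) := fun x => by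
    rw [← Equiv.sum_comp (Equiv.addLeft x)]
    refine Finset.sum_congr rfl fun z _ => ?_
    rw [Equiv.coe_addLeft, quadPhase_add, ← mul_assoc, ← mul_assoc, quadPhase_mul_self, one_mul]
  rw [quadSum, Finset.sum_mul_sum, Finset.sum_congr rfl fun x _ => h x, Finset.sum_comm]
  simp only [← Finset.mul_sum, sum_traceSign_mul, mul_ite, mul_zero]
  rw [← Finset.sum_filter, ← Finset.sum_mul, mul_comm]
  congr 1
  exact Finset.sum_subtype _ (by simp) _

open Classical in
theorem quadSum_mul_self_of_ne_zero {a b c : F} (h : quadSum σ a b c ≠ 0) :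
    quadSum σ a b c * quadSum σ a b c =
      Fintype.card F * Nat.card (LinearMap.ker (polarMap σ a b)) := by
  have hadd : ∀ x z : LinearMap.ker (polarMap σ a b), quadPhase σ a b c (x + z : F) =
      quadPhase σ a b c x * quadPhase σ a b c z := fun x z => by
    rw [quadPhase_add, LinearMap.mem_ker.1 z.2, zero_mul, traceSign_zero, mul_one]
  have hne : ∑ z : LinearMap.ker (polarMap σ a b), quadPhase σ a b c z ≠ 0 := fun h0 => by
    have := quadSum_mul_self σ a b c
    rw [h0, mul_zero] at this
    exact h (mul_self_eq_zero.1 this)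
  have hone : ∀ z : LinearMap.ker (polarMap σ a b), quadPhase σ a b c z = 1 := fun z => by
    refine (traceSign_eq_or _).resolve_right fun hz => hne ?_
    have hs := Equiv.sum_comp (Equiv.addRight z)
      fun x : LinearMap.ker (polarMap σ a b) => quadPhase σ a b c x
    simp only [Equiv.coe_addRight, Submodule.coe_add, hadd, ← Finset.sum_mul] at hs
    rw [show quadPhase σ a b c z = -1 from hz] at hs
    linarith
  rw [quadSum_mul_self, Finset.sum_congr rfl fun z _ => hone z]
  simp

theorem sum_quadSum_mul_self (a b : F) :
    ∑ c, quadSum σ a b c * quadSum σ a b c = (Fintype.card F : ℤ) ^ 2 := by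
  classical
  have h2 : ∀ x y : F, x + y = 0 ↔ y = x := fun x y => by
    have : x + x = 0 := by rw [← two_mul, two_eq_zero_of_algebra_zmod, zero_mul]
    rw [add_eq_zero_iff_eq_neg', ← add_eq_zero_iff_eq_neg.1 this]
  have h : ∀ c x y, quadPhase σ a b c x * quadPhase σ a b c y =
      quadPhase σ a b 0 x * quadPhase σ a b 0 y * traceSign ((x + y) * c) := fun c x y => by
    simp only [quadPhase, ← traceSign_add]
    congr 1; ring
  simp only [quadSum, Finset.sum_mul_sum]
  rw [Finset.sum_comm]
  calc ∑ x, ∑ c, ∑ y, quadPhase σ a b c x * quadPhase σ a b c y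
      = ∑ x : F, (Fintype.card F : ℤ) := Finset.sum_congr rfl fun x _ => by
        rw [Finset.sum_comm]
        rw [Finset.sum_congr rfl fun y _ => Finset.sum_congr rfl fun c _ => h c x y]
        simp only [← Finset.mul_sum, sum_traceSign_mul, h2]
        simp [quadPhase_mul_self]
    _ = _ := by simp [sq]

open Classical in
/-- For fixed `a` and `b`, the sum is nonzero for exactly `|F| / |ker|` values of `c`. -/
theorem card_quadSum_ne_zero_mul_card_ker (a b : F) :
    (Finset.univ.filter fun c => quadSum σ a b c ≠ 0).card *
      Nat.card (LinearMap.ker (polarMap σ a b)) = Fintype.card F := by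
  have h := sum_quadSum_mul_self σ a b
  rw [← Finset.sum_filter_of_ne (p := fun c => quadSum σ a b c ≠ 0)
      (fun c _ hc h0 => hc (by rw [h0, zero_mul])),
    Finset.sum_congr rfl fun c hc => quadSum_mul_self_of_ne_zero σ (Finset.mem_filter.1 hc).2,
    Finset.sum_const, nsmul_eq_mul] at h
  have hq : (Fintype.card F : ℤ) ≠ 0 := by exact_mod_cast Fintype.card_ne_zero
  have h' : (Fintype.card F : ℤ) * ((Finset.univ.filter fun c => quadSum σ a b c ≠ 0).card *
      Nat.card (LinearMap.ker (polarMap σ a b))) = Fintype.card F * Fintype.card F := by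
    linear_combination h
  exact_mod_cast mul_left_cancel₀ hq h'

/-- The total size of all radicals. -/
theorem sum_card_ker_polarMap :
    ∑ a : F, ∑ b : F, (Nat.card (LinearMap.ker (polarMap σ a b)) : ℤ) =
      Fintype.card F * (Fintype.card F +
        (Fintype.card F - 1) * Nat.card {x : F // σ x = x}) := by
  classical
  have hq : (Fintype.card F : ℤ) ≠ 0 := by exact_mod_cast Fintype.card_ne_zero
  have h2 : ∀ x : F, x + x = 0 := fun x => by
    rw [← two_mul, two_eq_zero_of_algebra_zmod, zero_mul]
  have hker : ∀ a b : F, (Fintype.card F : ℤ) * Nat.card (LinearMap.ker (polarMap σ a b)) =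
      ∑ x, ∑ y, traceSign (polarMap σ a b x * y) := fun a b => by
    simp only [sum_traceSign_mul]
    rw [← Finset.sum_filter, Finset.sum_const, nsmul_eq_mul, mul_comm]
    congr 2
    rw [Nat.card_eq_fintype_card]
    exact Fintype.card_subtype _
  have hdual : ∀ a b x y : F, traceSign (polarMap σ a b x * y) =
      traceSign ((y * σ (σ x) + x * σ (σ y)) * a) * traceSign ((y * σ x + x * σ y) * b) :=
    fun a b x y => by
      rw [← traceSign_add, traceSign, mul_comm, trace_mul_polarMap, traceSign, mul_comm a,
        mul_comm b]
  have hcard : ∀ x : F, (∑ y, if y * σ x + x * σ y = 0 then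
      (if y * σ (σ x) + x * σ (σ y) = 0 then (1 : ℤ) else 0) else 0) =
      if x = 0 then (Fintype.card F : ℤ) else (Nat.card {x : F // σ x = x} : ℤ) := fun x => by
    split_ifs with hx
    · simp [hx]
    · rw [← Equiv.sum_comp (Equiv.mulLeft₀ x hx), Nat.card_eq_fintype_card,
        Fintype.card_subtype, Finset.card_filter]
      push_cast
      refine Finset.sum_congr rfl fun t _ => ?_
      have hσx : σ x ≠ 0 := (map_ne_zero σ).2 hx
      have e1 : x * t * σ x + x * σ (x * t) = 0 ↔ σ t = t := by
        rw [map_mul, show x * t * σ x + x * (σ x * σ t) = x * σ x * (t + σ t) by ring,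
          mul_eq_zero_iff_left (mul_ne_zero hx hσx), add_eq_zero_iff_eq_neg,
          ← add_eq_zero_iff_eq_neg.1 (h2 (σ t)), eq_comm]
      simp only [Equiv.mulLeft₀_apply, e1]
      split_ifs with ht hc
      · rfl
      · refine absurd ?_ hc
        simp only [map_mul, ht]
        linear_combination h2 (x * t * σ (σ x))
      · rfl
  apply mul_left_cancel₀ hq
  apply mul_left_cancel₀ hq
  calc (Fintype.card F : ℤ) * (Fintype.card F *
        ∑ a : F, ∑ b : F, (Nat.card (LinearMap.ker (polarMap σ a b)) : ℤ))
      = Fintype.card F * ∑ a, ∑ b, ∑ x, ∑ y, traceSign (polarMap σ a b x * y) := by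
        simp only [← hker, ← Finset.mul_sum]
    _ = Fintype.card F * ∑ x, ∑ y, ∑ a, ∑ b, traceSign (polarMap σ a b x * y) := by
        congr 1
        calc _ = ∑ a, ∑ x, ∑ y, ∑ b, traceSign (polarMap σ a b x * y) :=
              Finset.sum_congr rfl fun a _ => by
                rw [Finset.sum_comm]
                exact Finset.sum_congr rfl fun x _ => Finset.sum_comm
          _ = _ := by
                rw [Finset.sum_comm]
                exact Finset.sum_congr rfl fun x _ => Finset.sum_comm
    _ = Fintype.card F ^ 3 * ∑ x, ∑ y, (if y * σ x + x * σ y = 0 then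
          (if y * σ (σ x) + x * σ (σ y) = 0 then (1 : ℤ) else 0) else 0) := by
        simp only [hdual, ← Finset.mul_sum, ← Finset.sum_mul, sum_traceSign_mul]
        rw [pow_succ', mul_assoc]
        congr 1
        simp only [Finset.mul_sum]
        refine Finset.sum_congr rfl fun x _ => Finset.sum_congr rfl fun y _ => ?_
        split_ifs <;> ring
    _ = _ := by
        simp only [hcard]
        rw [← Finset.add_sum_erase _ _ (Finset.mem_univ (0 : F)), if_pos rfl,
          Finset.sum_congr rfl fun x hx => if_neg (Finset.ne_of_mem_erase hx), Finset.sum_const,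
          Finset.card_erase_of_mem (Finset.mem_univ _), Finset.card_univ, nsmul_eq_mul,
          Nat.cast_sub Fintype.card_pos]
        push_cast
        ring

end QuadraticSum

theorem mem_fixedField_zpowers_iff {E L : Type*} [Field E] [Field L] [Algebra E L]
    (σ : L ≃ₐ[E] L) (x : L) :
    x ∈ IntermediateField.fixedField (Subgroup.zpowers σ) ↔ σ x = x := by
  rw [IntermediateField.mem_fixedField_iff]
  refine ⟨fun h => h σ (Subgroup.mem_zpowers σ), fun h f hf => ?_⟩
  have hle : Subgroup.zpowers σ ≤ MulAction.stabilizer (L ≃ₐ[E] L) x :=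
    Subgroup.zpowers_le.2 h
  exact hle hf

theorem finrank_fixedField_zpowers {E L : Type*} [Field E] [Field L] [Algebra E L]
    [FiniteDimensional E L] (σ : L ≃ₐ[E] L) :
    finrank (IntermediateField.fixedField (Subgroup.zpowers σ)) L = orderOf σ := by
  rw [IntermediateField.finrank_fixedField_eq_card, Nat.card_zpowers]

theorem card_fixedPoints_eq_card_fixedField {E L : Type*} [Field E] [Field L] [Algebra E L]
    (σ : L ≃ₐ[E] L) :
    Nat.card {x : L // σ x = x} =
      Nat.card (IntermediateField.fixedField (Subgroup.zpowers σ)) :=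
  Nat.card_congr (Equiv.subtypeEquivRight fun x => (mem_fixedField_zpowers_iff σ x).symm)

section Counting

variable {F : Type*} [Field F] [Fintype F] [Algebra (ZMod 2) F] (σ : F ≃ₐ[ZMod 2] F)

theorem card_fixedPoints_pow_orderOf :
    Nat.card {x : F // σ x = x} ^ orderOf σ = Fintype.card F := by
  rw [card_fixedPoints_eq_card_fixedField, ← finrank_fixedField_zpowers,
    ← Module.natCard_eq_pow_finrank, Nat.card_eq_fintype_card]

theorem card_ker_polarMap_eq_card_fixedPoints_or (hodd : Odd (orderOf σ)) {a b : F}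
    (hab : a ≠ 0 ∨ b ≠ 0) :
    Nat.card (LinearMap.ker (polarMap σ a b)) = Nat.card {x : F // σ x = x} ∨
      Nat.card (LinearMap.ker (polarMap σ a b)) = Nat.card {x : F // σ x = x} ^ 3 := by
  let τ : F ≃ₐ[IntermediateField.fixedField (Subgroup.zpowers σ)] F :=
    AlgEquiv.ofRingEquiv (f := (σ : F ≃+* F)) fun x => (mem_fixedField_zpowers_iff σ x).1 x.2
  rw [card_fixedPoints_eq_card_fixedField]
  exact card_ker_polarMap_eq_or two_eq_zero_of_algebra_zmod τ
    (fun x hx => ⟨⟨x, (mem_fixedField_zpowers_iff σ x).2 hx⟩, rfl⟩)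
    (finrank_fixedField_zpowers σ ▸ hodd) hab

/-- The number of vanishing quadratic sums, in terms of the sizes `q` of the field and `Q` of
the fixed field of `σ`. -/
theorem card_quadSum_eq_zero (hodd : Odd (orderOf σ)) {q Q : ℤ} (hq : q = Fintype.card F)
    (hQ : Q = Nat.card {x : F // σ x = x}) :
    Q ^ 4 * ({t : F × F × F | quadSum σ t.1 t.2.1 t.2.2 = 0}.ncard : ℤ) =
      Q ^ 4 * (q ^ 3 - 1) -
        q * ((q ^ 2 - 1) * (Q ^ 3 + Q) - (q * (q + (q - 1) * Q) - q)) := by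
  classical
  let N : F → F → ℕ := fun a b => (Finset.univ.filter fun c => quadSum σ a b c ≠ 0).card
  have hN : ∀ a b, (N a b : ℤ) * Nat.card (LinearMap.ker (polarMap σ a b)) = q := fun a b => by
    rw [hq]; exact_mod_cast card_quadSum_ne_zero_mul_card_ker σ a b
  have hq0 : q ≠ 0 := by rw [hq]; exact_mod_cast Fintype.card_ne_zero
  have hcount : ({t : F × F × F | quadSum σ t.1 t.2.1 t.2.2 = 0}.ncard : ℤ) =
      ∑ a : F, ∑ b : F, (q - N a b) := by
    rw [Set.ncard_eq_toFinset_card', Set.toFinset_ofPred, Finset.card_filter]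
    push_cast
    rw [Fintype.sum_prod_type]
    refine Finset.sum_congr rfl fun a _ => ?_
    rw [Fintype.sum_prod_type]
    refine Finset.sum_congr rfl fun b _ => ?_
    have h := Finset.card_filter_add_card_filter_not (s := Finset.univ)
      (fun c => quadSum σ a b c = 0)
    rw [Finset.card_univ] at h
    rw [hq, ← h, Finset.card_filter]
    push_cast
    simp [N]
  have hpair : ∀ a b : F, Q ^ 4 * (N a b : ℤ) =
      q * (Q ^ 3 + Q - Nat.card (LinearMap.ker (polarMap σ a b))) +
        if a = 0 then (if b = 0 then Q ^ 4 - q * (Q ^ 3 + Q - q) else 0) else 0 := by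
    intro a b
    have hab := hN a b
    by_cases h : a ≠ 0 ∨ b ≠ 0
    · have hif : (if a = 0 then (if b = 0 then Q ^ 4 - q * (Q ^ 3 + Q - q) else 0) else 0) = 0 := by
        rcases h with h | h <;> simp [h]
      rw [hif]
      rcases card_ker_polarMap_eq_card_fixedPoints_or σ hodd h with h | h
      · rw [h, ← hQ] at hab ⊢
        linear_combination Q ^ 3 * hab
      · rw [h, Nat.cast_pow, ← hQ] at hab ⊢
        linear_combination Q * hab
    · push Not at h
      obtain ⟨rfl, rfl⟩ := h
      have hker : (Nat.card (LinearMap.ker (polarMap σ 0 0)) : ℤ) = q := by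
        have : LinearMap.ker (polarMap σ (0 : F) 0) = ⊤ := by
          refine LinearMap.ker_eq_top.2 (LinearMap.ext fun x => ?_)
          simp [polarMap_apply]
        rw [this, hq, Nat.card_congr Submodule.topEquiv.toEquiv, Nat.card_eq_fintype_card]
      rw [hker] at hab ⊢
      have : (N 0 0 : ℤ) = 1 := mul_right_cancel₀ hq0 (by rw [hab, one_mul])
      rw [this]
      simp
  have hsum := sum_card_ker_polarMap σ
  rw [← hq, ← hQ] at hsum
  have htotal : Q ^ 4 * ∑ a : F, ∑ b : F, (N a b : ℤ) =
      q * (q ^ 2 * (Q ^ 3 + Q) - q * (q + (q - 1) * Q)) + (Q ^ 4 - q * (Q ^ 3 + Q - q)) := by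
    simp only [Finset.mul_sum, hpair, Finset.sum_add_distrib]
    simp only [← Finset.mul_sum, Finset.sum_sub_distrib, hsum]
    simp only [Finset.sum_const, Finset.card_univ, nsmul_eq_mul, ← hq]
    simp only [Finset.sum_ite_irrel, Finset.sum_ite_eq', Finset.mem_univ, if_true,
      Finset.sum_const_zero]
    ring
  rw [hcount]
  simp only [Finset.sum_sub_distrib, mul_sub, htotal]
  simp [← hq]
  ring

end Counting

/-- with d = gcd(n,k), n/d odd and k ∉ {n/3, 2n/3}, the number of
triples (α,β,γ) ∈ F_q³ with S(α,β,γ) = 0 is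
(2^n-1)(2^{2n} - 2^{2n-d} + 2^{2n-4d} + 2^n - 2^{n-d} - 2^{n-3d} + 1). -/
theorem stmt_15 (n k : ℕ) (hn : 0 < n) (hk : 0 < k) (d : ℕ) (hd : d = Nat.gcd n k)
    (hodd : Odd (n / d)) (hk1 : 3 * k ≠ n) (hk2 : 3 * k ≠ 2 * n)
    [Fintype (GaloisField 2 n)] :
    ({t : GaloisField 2 n × GaloisField 2 n × GaloisField 2 n |
        (∑ x : GaloisField 2 n,
          (-1 : ℤ) ^ (Algebra.trace (ZMod 2) (GaloisField 2 n)
            (t.1 * x ^ (2 ^ (2 * k) + 1) + t.2.1 * x ^ (2 ^ k + 1) + t.2.2 * x)).val) = 0}.ncard : ℤ)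
      = (2 ^ n - 1) * (2 ^ (2 * n) - 2 ^ (2 * n - d) + 2 ^ (2 * n - 4 * d)
          + 2 ^ n - 2 ^ (n - d) - 2 ^ (n - 3 * d) + 1) := by
  let σ : GaloisField 2 n ≃ₐ[ZMod 2] GaloisField 2 n :=
    FiniteField.frobeniusAlgEquivOfAlgebraic (ZMod 2) (GaloisField 2 n) ^ k
  have hσ : ∀ x, σ x = x ^ 2 ^ k := fun x => by
    simp only [σ, AlgEquiv.coe_pow, FiniteField.coe_frobeniusAlgEquivOfAlgebraic_iterate,
      ZMod.card]
  have horder : orderOf σ = n / d := by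
    rw [orderOf_pow, FiniteField.orderOf_frobeniusAlgEquivOfAlgebraic,
      GaloisField.finrank 2 hn.ne', hd]
  have hcardF : Fintype.card (GaloisField 2 n) = 2 ^ n := by
    rw [← Nat.card_eq_fintype_card, GaloisField.card 2 n hn.ne']
  obtain ⟨m, hm⟩ : d ∣ n := hd ▸ Nat.gcd_dvd_left n k
  have hd0 : 0 < d := hd ▸ Nat.gcd_pos_of_pos_left k hn
  have hnd : n / d = m := by rw [hm, Nat.mul_div_cancel_left m hd0]
  rw [hnd] at hodd horder
  have hcardK : Nat.card {x : GaloisField 2 n // σ x = x} = 2 ^ d := by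
    have h := card_fixedPoints_pow_orderOf σ
    rw [hcardF, horder, show 2 ^ n = (2 ^ d) ^ m by rw [← pow_mul, ← hm]] at h
    exact Nat.pow_left_injective hodd.pos.ne' h
  have hset : {t : GaloisField 2 n × GaloisField 2 n × GaloisField 2 n |
        (∑ x : GaloisField 2 n,
          (-1 : ℤ) ^ (Algebra.trace (ZMod 2) (GaloisField 2 n)
            (t.1 * x ^ (2 ^ (2 * k) + 1) + t.2.1 * x ^ (2 ^ k + 1) + t.2.2 * x)).val) = 0} =
      {t | quadSum σ t.1 t.2.1 t.2.2 = 0} := by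
    ext t
    simp only [Set.mem_ofPred_eq, quadSum, quadPhase, traceSign, hσ, ← pow_mul, ← pow_add,
      ← two_mul, ← pow_succ']
  have hmain := card_quadSum_eq_zero σ (horder ▸ hodd) (q := 2 ^ n) (Q := 2 ^ d)
    (by rw [hcardF]; norm_cast) (by rw [hcardK]; norm_cast)
  rw [hset]
  have hQ : ((2 : ℤ) ^ d) ^ 4 ≠ 0 := by positivity
  apply mul_left_cancel₀ hQ
  rw [hmain]
  obtain ⟨s, hs⟩ := hodd
  rcases Nat.eq_zero_or_pos s with rfl | hs0
  · obtain rfl : n = d := by rw [hm, hs]; ring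
    rw [show 2 * n - n = n by omega, show 2 * n - 4 * n = 0 by omega,
      show n - 3 * n = 0 by omega, Nat.sub_self]
    ring
  · obtain ⟨e, he⟩ : ∃ e, n = 3 * d + e := by
      refine ⟨2 * (s - 1) * d, ?_⟩
      obtain ⟨u, rfl⟩ : ∃ u, s = u + 1 := ⟨s - 1, by omega⟩
      rw [hm, hs, Nat.add_sub_cancel]; ring
    rw [show 2 * n - d = 5 * d + 2 * e by omega, show 2 * n - 4 * d = 2 * d + 2 * e by omega,
      show n - 3 * d = e by omega, show n - d = 2 * d + e by omega, he]
    simp only [pow_add, pow_mul', mul_add]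
    ring
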